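/- (Theorem 3.1(i), Faithfulness) Let φ ∈ ℝ and let |Ψ_φ⟩ = (|000⟩ + e^{iφ}|111⟩)/√2 ∈ ℂ² ⊗ ℂ² ⊗ ℂ² be the state obtained by applying P(φ) to qubit 0 of the GHZ state. For a, b ∈ {0,1}, let |x_a⟩ = (|0⟩ + (−1)^a|1⟩)/√2. Then projecting qubit 0 of |Ψ_φ⟩ onto |x_a⟩ and qubit 1 onto |x_b⟩, and applying Z^{a⊕b} to qubit 2 (where Z = diag(1,−1)), yields the vector (1/2)·(|0⟩ + e^{iφ}|1⟩)/√2 on qubit 2; i.e., for every pair of X-measurement outcomes, after the Pauli correction Charlie's normalized state is exactly P(φ)|+⟩, with magic content C(φ) = (|sin φ| + |cos φ| − 1)/2. -/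

import Mathlib

open Complex Matrix Finset

noncomputable section

/-- Pauli X -/
def pauliX : Matrix (Fin 2) (Fin 2) ℂ := !![0, 1; 1, 0]
/-- Pauli Y -/
def pauliY : Matrix (Fin 2) (Fin 2) ℂ := !![0, -Complex.I; Complex.I, 0]
/-- Pauli Z -/
def pauliZ : Matrix (Fin 2) (Fin 2) ℂ := !![1, 0; 0, -1]

/-- Phase-point operators A_{(q,p)} -/
def phasePoint (q p : Fin 2) : Matrix (Fin 2) (Fin 2) ℂ :=
  (1/2 : ℂ) • (1 + ((-1 : ℂ) ^ (p : ℕ)) • pauliX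
    + ((-1 : ℂ) ^ ((q : ℕ) + (p : ℕ))) • pauliY + ((-1 : ℂ) ^ (q : ℕ)) • pauliZ)

/-- Wigner vector W_ρ(q,p) = (1/2) tr(ρ A_{(q,p)}) of a single-qubit operator -/
def wigner (ρ : Matrix (Fin 2) (Fin 2) ℂ) (q p : Fin 2) : ℝ :=
  ((1/2 : ℂ) * (ρ * phasePoint q p).trace).re

/-- Wigner vector from a Bloch vector (x,y,z) -/
def wignerBloch (x y z : ℝ) : Fin 2 → Fin 2 → ℝ :=
  fun q p => (1/4) * (1 + (-1 : ℝ) ^ (p : ℕ) * x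
    + (-1 : ℝ) ^ ((q : ℕ) + (p : ℕ)) * y + (-1 : ℝ) ^ (q : ℕ) * z)

/-- Wigner vectors of the six pure single-qubit stabilizer states
    (the Pauli eigenstates, Bloch vectors (±1,0,0), (0,±1,0), (0,0,±1)) -/
def stabWigners : Set (Fin 2 → Fin 2 → ℝ) :=
  {wignerBloch 1 0 0, wignerBloch (-1) 0 0, wignerBloch 0 1 0,
   wignerBloch 0 (-1) 0, wignerBloch 0 0 1, wignerBloch 0 0 (-1)}

/-- The stabilizer polytope: convex hull of the six stabilizer Wigner vectors -/
def stabPolytope : Set (Fin 2 → Fin 2 → ℝ) := convexHull ℝ stabWigners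

/-- ℓ₁ norm on ℝ⁴ -/
def l1norm (g : Fin 2 → Fin 2 → ℝ) : ℝ := ∑ q : Fin 2, ∑ p : Fin 2, |g q p|

/-- Wigner distance (magic monotone): C(ρ) = min_{f ∈ 𝒲_free} ‖W_ρ − f‖₁ -/
def Cdist (ρ : Matrix (Fin 2) (Fin 2) ℂ) : ℝ :=
  sInf { d | ∃ f ∈ stabPolytope, d = l1norm (fun q p => wigner ρ q p - f q p) }

/-- the phase-gate state P(φ)|+⟩ = (|0⟩ + e^{iφ}|1⟩)/√2 -/
def phaseKet (φ : ℝ) : Fin 2 → ℂ :=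
  fun j => (if j = 0 then 1 else Complex.exp (φ * Complex.I)) / Real.sqrt 2

/-- density matrix |φ⟩⟨φ| -/
def phaseRho (φ : ℝ) : Matrix (Fin 2) (Fin 2) ℂ :=
  fun j k => phaseKet φ j * star (phaseKet φ k)


/-- |Ψ_φ⟩ = (|000⟩ + e^{iφ}|111⟩)/√2 : P(φ) applied to qubit 0 of the GHZ state. -/
def PsiPhi (φ : ℝ) : Fin 2 → Fin 2 → Fin 2 → ℂ :=
  fun i j k =>
    ((if i = 0 ∧ j = 0 ∧ k = 0 then 1 else 0)
      + Complex.exp (φ * Complex.I) * (if i = 1 ∧ j = 1 ∧ k = 1 then 1 else 0))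
      / Real.sqrt 2

/-- X-measurement eigenstate |x_a⟩ = (|0⟩ + (−1)^a|1⟩)/√2 -/
def xKet (a : Fin 2) : Fin 2 → ℂ :=
  fun i => (if i = 0 then 1 else (-1 : ℂ) ^ (a : ℕ)) / Real.sqrt 2

/-- Project qubit 0 of |Ψ_φ⟩ onto |x_a⟩ and qubit 1 onto |x_b⟩, then apply
    Z^{a⊕b} to qubit 2. -/
def charlieState (φ : ℝ) (a b : Fin 2) : Fin 2 → ℂ :=
  fun k => (if k = 1 then (-1 : ℂ) ^ (((a + b : Fin 2) : ℕ)) else 1) *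
    ∑ i : Fin 2, ∑ j : Fin 2, star (xKet a i) * star (xKet b j) * PsiPhi φ i j k

lemma wigner_phaseRho (φ : ℝ) :
    wigner (phaseRho φ) = wignerBloch (Real.cos φ) (Real.sin φ) 0 := by
  have h2 : (Real.sqrt 2) * (Real.sqrt 2) = 2 := Real.mul_self_sqrt (by norm_num)
  have h2c : ((Real.sqrt 2 : ℝ) : ℂ) * ((Real.sqrt 2 : ℝ) : ℂ) = 2 := by
    rw [← Complex.ofReal_mul, h2]; norm_num
  have e00 : phaseRho φ 0 0 = 1 / 2 := by
    simp only [phaseRho, phaseKet]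
    simp [← mul_inv, h2c]
  have e01 : phaseRho φ 0 1 = (Real.cos φ - Real.sin φ * I) / 2 := by
    simp only [phaseRho, phaseKet, Complex.exp_mul_I]
    simp only [← Complex.ofReal_cos, ← Complex.ofReal_sin]
    simp [← Complex.cos_conj, ← Complex.sin_conj]
    rw [← h2c]; field_simp; ring
  have e10 : phaseRho φ 1 0 = (Real.cos φ + Real.sin φ * I) / 2 := by
    simp only [phaseRho, phaseKet, Complex.exp_mul_I]
    simp only [← Complex.ofReal_cos, ← Complex.ofReal_sin]
    simp
    rw [← h2c]; field_simp
  have e11 : phaseRho φ 1 1 = 1 / 2 := by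
    simp only [phaseRho, phaseKet, Complex.exp_mul_I]
    simp only [← Complex.ofReal_cos, ← Complex.ofReal_sin]
    simp [← Complex.cos_conj, ← Complex.sin_conj]
    have hcs : ((Real.cos φ : ℝ) : ℂ) ^ 2 + ((Real.sin φ : ℝ) : ℂ) ^ 2 = 1 := by
      rw [← Complex.ofReal_pow, ← Complex.ofReal_pow, ← Complex.ofReal_add,
        Real.cos_sq_add_sin_sq, Complex.ofReal_one]
    rw [div_mul_div_comm, h2c]
    push_cast at hcs
    linear_combination (1/2) * hcs - (1/2) * Complex.sin φ ^ 2 * Complex.I_sq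
  funext q p
  unfold wigner
  rw [Matrix.trace_fin_two, Matrix.mul_apply, Matrix.mul_apply, Fin.sum_univ_two,
    Fin.sum_univ_two, e00, e01, e10, e11]
  generalize Real.cos φ = c
  generalize Real.sin φ = s
  fin_cases q <;> fin_cases p <;>
    simp [phasePoint, wignerBloch, pauliX, pauliY, pauliZ] <;> ring

lemma polytope_bound {f : Fin 2 → Fin 2 → ℝ} (hf : f ∈ stabPolytope) :
    |f 0 0 - f 0 1| ≤ 1 / 2 ∧ |f 1 0 - f 1 1| ≤ 1 / 2 := by
  have hsub : stabPolytope ⊆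
      {f : Fin 2 → Fin 2 → ℝ | |f 0 0 - f 0 1| ≤ 1 / 2 ∧ |f 1 0 - f 1 1| ≤ 1 / 2} := by
    apply convexHull_min
    · intro g hg
      simp only [stabWigners, Set.mem_insert_iff, Set.mem_singleton_iff] at hg
      rcases hg with rfl | rfl | rfl | rfl | rfl | rfl <;>
        simp only [wignerBloch, Set.mem_ofPred_eq] <;> norm_num
    · intro g hg h hh α β hα hβ hαβ
      simp only [Set.mem_ofPred_eq, abs_le, Pi.add_apply, Pi.smul_apply, smul_eq_mul] at *
      obtain ⟨⟨g1, g2⟩, g3, g4⟩ := hg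
      obtain ⟨⟨h1, h2⟩, h3, h4⟩ := hh
      obtain rfl : β = 1 - α := by linarith
      refine ⟨⟨?_, ?_⟩, ?_, ?_⟩ <;> nlinarith
  exact hsub hf

lemma mem_polytope (x y : ℝ) (h : |x| + |y| = 1) : wignerBloch x y 0 ∈ stabPolytope := by
  have hc : Convex ℝ stabPolytope := convex_convexHull ℝ _
  have hs : stabWigners ⊆ stabPolytope := subset_convexHull ℝ _
  have key : ∀ u v : ℝ, wignerBloch u 0 0 ∈ stabPolytope → wignerBloch 0 v 0 ∈ stabPolytope →
      x = |x| * u → y = |y| * v → wignerBloch x y 0 ∈ stabPolytope := by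
    intro u v hu hv hx hy
    have := hc hu hv (abs_nonneg x) (abs_nonneg y) h
    convert this using 1
    funext q p
    simp only [wignerBloch, Pi.add_apply, Pi.smul_apply, smul_eq_mul]
    linear_combination (1/4) * (-1 : ℝ) ^ (p : ℕ) * hx
      + (1/4) * (-1 : ℝ) ^ ((q : ℕ) + (p : ℕ)) * hy - (1/4) * h
  have m1 : wignerBloch 1 0 0 ∈ stabPolytope := hs (by simp [stabWigners])
  have m2 : wignerBloch (-1) 0 0 ∈ stabPolytope := hs (by simp [stabWigners])
  have m3 : wignerBloch 0 1 0 ∈ stabPolytope := hs (by simp [stabWigners])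
  have m4 : wignerBloch 0 (-1) 0 ∈ stabPolytope := hs (by simp [stabWigners])
  rcases le_total 0 x with hx | hx <;> rcases le_total 0 y with hy | hy
  · exact key 1 1 m1 m3 (by simp [abs_of_nonneg hx]) (by simp [abs_of_nonneg hy])
  · exact key 1 (-1) m1 m4 (by simp [abs_of_nonneg hx]) (by simp [abs_of_nonpos hy])
  · exact key (-1) 1 m2 m3 (by simp [abs_of_nonpos hx]) (by simp [abs_of_nonneg hy])
  · exact key (-1) (-1) m2 m4 (by simp [abs_of_nonpos hx]) (by simp [abs_of_nonpos hy])

/-- In the plane z = 0 the ℓ₁ distance is the maximum of the coordinate distances. -/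
lemma l1_plane (c s x y t : ℝ) (ht : 0 ≤ t) (hx : |c - x| = t) (hy : |s - y| = t) :
    l1norm (fun q p => wignerBloch c s 0 q p - wignerBloch x y 0 q p) = t := by
  have e : l1norm (fun q p => wignerBloch c s 0 q p - wignerBloch x y 0 q p)
      = (|((c - x) + (s - y)) / 4| + |-(((c - x) + (s - y)) / 4)|)
        + (|((c - x) - (s - y)) / 4| + |-(((c - x) - (s - y)) / 4)|) := by
    simp only [l1norm, wignerBloch, Fin.sum_univ_two]
    congr 3 <;> norm_num <;> ring
  rw [e, abs_neg, abs_neg]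
  rcases eq_or_eq_neg_of_abs_eq hx with h1 | h1 <;>
    rcases eq_or_eq_neg_of_abs_eq hy with h2 | h2 <;> rw [h1, h2]
  · rw [abs_of_nonneg (show 0 ≤ (t + t) / 4 by linarith), sub_self]; norm_num; ring
  · rw [abs_of_nonneg (show 0 ≤ (t - -t) / 4 by linarith), add_neg_cancel]; norm_num; ring
  · rw [abs_of_nonpos (show (-t - t) / 4 ≤ 0 by linarith), neg_add_cancel]; norm_num; ring
  · rw [abs_of_nonpos (show (-t + -t) / 4 ≤ 0 by linarith), sub_self]; norm_num; ring

lemma exists_shift (c t : ℝ) (ht : 0 ≤ t) (h : t ≤ |c|) :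
    ∃ x, |c - x| = t ∧ |x| = |c| - t := by
  rcases le_total 0 c with hc | hc
  · rw [abs_of_nonneg hc] at h ⊢
    exact ⟨c - t, by rw [sub_sub_cancel, abs_of_nonneg ht], abs_of_nonneg (by linarith)⟩
  · rw [abs_of_nonpos hc] at h ⊢
    refine ⟨c + t, ?_, ?_⟩
    · rw [sub_add_cancel_left, abs_neg, abs_of_nonneg ht]
    · rw [abs_of_nonpos (by linarith)]; ring

lemma Cdist_phaseRho (φ : ℝ) :
    Cdist (phaseRho φ) = (|Real.sin φ| + |Real.cos φ| - 1) / 2 := by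
  unfold Cdist
  rw [wigner_phaseRho]
  have hcs := Real.sin_sq_add_cos_sq φ
  have hc1 := Real.abs_cos_le_one φ
  have hs1 := Real.abs_sin_le_one φ
  generalize Real.cos φ = c at *
  generalize Real.sin φ = s at *
  have hc0 := abs_nonneg c
  have hs0 := abs_nonneg s
  have hge : 1 ≤ |s| + |c| := by
    rw [← sq_abs s, ← sq_abs c] at hcs
    nlinarith
  apply IsLeast.csInf_eq
  constructor
  · obtain ⟨x, hx1, hx2⟩ := exists_shift c ((|s| + |c| - 1) / 2) (by linarith) (by linarith)
    obtain ⟨y, hy1, hy2⟩ := exists_shift s ((|s| + |c| - 1) / 2) (by linarith) (by linarith)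
    exact ⟨wignerBloch x y 0, mem_polytope x y (by linarith),
      (l1_plane c s x y _ (by linarith) hx1 hy1).symm⟩
  · rintro d ⟨f, hf, rfl⟩
    obtain ⟨h1, h2⟩ := polytope_bound hf
    rw [abs_le] at h1 h2
    simp only [l1norm, wignerBloch, Fin.sum_univ_two]
    have b (r : ℝ) : r ≤ |r| ∧ -r ≤ |r| := ⟨le_abs_self r, neg_le_abs r⟩
    generalize hA : |_ - f 0 0| = A
    generalize hB : |_ - f 0 1| = B
    generalize hC : |_ - f 1 0| = C
    generalize hD : |_ - f 1 1| = D
    have bA := hA ▸ b _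
    have bB := hB ▸ b _
    have bC := hC ▸ b _
    have bD := hD ▸ b _
    clear hA hB hC hD
    norm_num at bA bB bC bD
    rcases abs_cases s with hs | hs <;> rcases abs_cases c with hc | hc <;>
      rw [hs.1, hc.1] <;> linarith [bA.1, bA.2, bB.1, bB.2, bC.1, bC.2, bD.1, bD.2]

lemma charlie_eq (φ : ℝ) (a b : Fin 2) :
    charlieState φ a b = (1/2 : ℂ) • phaseKet φ := by
  have h2 : (Real.sqrt 2) * (Real.sqrt 2) = 2 := Real.mul_self_sqrt (by norm_num)
  have h2c : ((Real.sqrt 2 : ℝ) : ℂ)⁻¹ * ((Real.sqrt 2 : ℝ) : ℂ)⁻¹ = 1 / 2 := by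
    rw [← mul_inv, ← Complex.ofReal_mul, h2]; norm_num
  funext k
  simp only [charlieState, Fin.sum_univ_two, xKet, PsiPhi, phaseKet, Pi.smul_apply, smul_eq_mul,
    div_eq_mul_inv]
  fin_cases a <;> fin_cases b <;> fin_cases k <;> simp [h2c]

/-- Faithfulness: for every pair of X-measurement outcomes (a,b),
    after the Pauli correction Z^{a⊕b}, Charlie's (unnormalized) state is exactly
    (1/2)·P(φ)|+⟩; the normalized state P(φ)|+⟩ has magic content
    C(φ) = (|sin φ| + |cos φ| − 1)/2. -/
theorem MSS_faithfulness (φ : ℝ) (a b : Fin 2) :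
    charlieState φ a b = (1/2 : ℂ) • phaseKet φ ∧
    Cdist (phaseRho φ) = (|Real.sin φ| + |Real.cos φ| - 1) / 2 := by
  exact ⟨charlie_eq φ a b, Cdist_phaseRho φ⟩

end
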